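/- For any real polynomial s of degree at most 3 and any real numbers a and h > 0, the energy of s over the interval [a, a+h] is given by ∫_a^{a+h} |s″(x)|² dx = (1/h)·(s′(a+h) − s′(a))² + (3/h)·[ (s′(a+h) + s′(a)) − 2·(s(a+h) − s(a))/h ]². -/

import Mathlib

open Polynomial

/-- Energy of a cubic polynomial over `[a, a+h]`:
`∫_a^{a+h} |s''(x)|² dx = (1/h)(s'(a+h) - s'(a))² + (3/h)[(s'(a+h) + s'(a)) - 2(s(a+h) - s(a))/h]²`. -/
theorem cubic_energy_formula
    (p : Polynomial ℝ) (hp : p.degree ≤ 3) (a h : ℝ) (hh : 0 < h) :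
    ∫ x in a..(a + h),
        ((Polynomial.derivative (Polynomial.derivative p)).eval x) ^ 2
      = (1 / h) * (p.derivative.eval (a + h) - p.derivative.eval a) ^ 2
        + (3 / h) * ((p.derivative.eval (a + h) + p.derivative.eval a)
            - 2 * (p.eval (a + h) - p.eval a) / h) ^ 2 := by
  obtain ⟨b, c, d, e, rfl⟩ : ∃ b c d e : ℝ, p = C b + C c * X + C d * X ^ 2 + C e * X ^ 3 := by
    refine ⟨p.coeff 0, p.coeff 1, p.coeff 2, p.coeff 3, ?_⟩
    have hn : p.natDegree < 4 := Nat.lt_succ_of_le (natDegree_le_of_degree_le hp)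
    conv_lhs => rw [p.as_sum_range_C_mul_X_pow' hn]
    simp [Finset.sum_range_succ]
  have hderiv (x : ℝ) : HasDerivAt
      (fun y ↦ (C (4 * d ^ 2) * X + C (12 * d * e) * X ^ 2 + C (12 * e ^ 2) * X ^ 3 : ℝ[X]).eval y)
      (((derivative (derivative (C b + C c * X + C d * X ^ 2 + C e * X ^ 3))).eval x) ^ 2) x := by
    refine (Polynomial.hasDerivAt _ x).congr_deriv ?_
    simp [-map_mul, -map_pow]
    ring
  rw [intervalIntegral.integral_eq_sub_of_hasDerivAt (fun x _ ↦ hderiv x)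
    ((Polynomial.continuous _).pow 2 |>.intervalIntegrable _ _)]
  simp
  field_simp
  ring
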